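/- Suppose the collection 𝒫_A^⊆ of potential-outcome distributions obeys distributional consistency and 𝒫_A obeys the SWIG ordered local Markov property for the DAG 𝒢 under ≺. Then the observed distribution p(V) obeys the ordinary ordered local Markov property with respect to 𝒢 and ≺: for every i ∈ V and every v* ∈ 𝔛_{pre(i)} with p(X_{pre(i)} = v*) > 0, the conditional distribution p(X_i = · | X_{pre(i)} = v*) is a function only of v*_{pa(i)}. -/

import Mathlib

open Finset

namespace CausalPaper

variable {V : Type*} [Fintype V] [LinearOrder V]
variable {𝔛 : V → Type*} [∀ i, Fintype (𝔛 i)]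

/-- Probability of the event `E` under the distribution `q` on joint assignments. -/
noncomputable def pr (q : (∀ i, 𝔛 i) → ℝ) (E : (∀ i, 𝔛 i) → Prop) : ℝ :=
  ∑ v : (∀ i, 𝔛 i), Set.indicator (setOf E) q v

/-- Conditional probability of `E` given `F` under `q`. -/
noncomputable def cpr (q : (∀ i, 𝔛 i) → ℝ) (E F : (∀ i, 𝔛 i) → Prop) : ℝ :=
  pr q (fun v => E v ∧ F v) / pr q F

/-- `q` is a probability distribution on joint assignments. -/
def IsProb (q : (∀ i, 𝔛 i) → ℝ) : Prop :=
  (∀ v, 0 ≤ q v) ∧ (∑ v : (∀ i, 𝔛 i), q v) = 1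

/-- `v` agrees with `s` on the coordinates in `S`. -/
def agree (S : Finset V) (s v : ∀ i, 𝔛 i) : Prop :=
  ∀ i ∈ S, v i = s i

/-- The intervention/regime that sets the variables in `B` according to `b`
(and is idle elsewhere). -/
def setOn (B : Finset V) (b : ∀ i, 𝔛 i) : ∀ i, Option (𝔛 i) :=
  fun i => if i ∈ B then some (b i) else none

/-- The support of the partial intervention/regime `f` is contained in `A`. -/
def suppIn (f : ∀ i, Option (𝔛 i)) (A : Finset V) : Prop :=
  ∀ i, f i ≠ none → i ∈ A

/-- Distributional consistency. -/
def DistConsistent (A : Finset V) (P : (∀ i, Option (𝔛 i)) → (∀ i, 𝔛 i) → ℝ) : Prop :=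
  ∀ i ∈ A, ∀ C : Finset V, C ⊆ A \ {i} →
    ∀ (y : ∀ j, 𝔛 j) (b : 𝔛 i) (c : ∀ j, 𝔛 j),
      pr (P (Function.update (setOn C c) i (some b)))
          (fun v => agree (univ \ {i}) y v ∧ v i = b)
        = pr (P (setOn C c)) (fun v => agree (univ \ {i}) y v ∧ v i = b)

/-- The predecessors of `i` under the total order on `V`. -/
def pre (i : V) : Finset V := univ.filter (fun j => j < i)

/-- The (SWIG / augmented-DAG) ordered local Markov property: under the regime
intervening on all of `A`, the conditional distribution of `X_i` given its
predecessors is a function only of `a` on `pa i ∩ A` and of `w` on `pa i \ A`. -/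
def SWIGLocalMarkov (A : Finset V) (pa : V → Finset V)
    (P : (∀ i, Option (𝔛 i)) → (∀ i, 𝔛 i) → ℝ) : Prop :=
  ∀ (i : V) (a a' w w' : ∀ j, 𝔛 j) (x : 𝔛 i),
    0 < pr (P (setOn A a)) (agree (pre i) w) →
    0 < pr (P (setOn A a')) (agree (pre i) w') →
    (∀ j ∈ pa i ∩ A, a j = a' j) →
    (∀ j ∈ pa i \ A, w j = w' j) →
    cpr (P (setOn A a)) (fun v => v i = x) (agree (pre i) w)
      = cpr (P (setOn A a')) (fun v => v i = x) (agree (pre i) w')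

/-- The ordinary ordered local Markov property for a single distribution `q`:
the conditional distribution of `X_i` given its predecessors is a function only
of the values of the parents. -/
def OrderedLocalMarkov (pa : V → Finset V) (q : (∀ i, 𝔛 i) → ℝ) : Prop :=
  ∀ (i : V) (w w' : ∀ j, 𝔛 j) (x : 𝔛 i),
    0 < pr q (agree (pre i) w) →
    0 < pr q (agree (pre i) w') →
    (∀ j ∈ pa i, w j = w' j) →
    cpr q (fun v => v i = x) (agree (pre i) w)
      = cpr q (fun v => v i = x) (agree (pre i) w')

theorem pr_nonneg {q : (∀ i, 𝔛 i) → ℝ} (hq : ∀ v, 0 ≤ q v) (E : (∀ i, 𝔛 i) → Prop) :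
    0 ≤ pr q E :=
  Finset.sum_nonneg fun v _ => Set.indicator_nonneg (fun v _ => hq v) v

theorem pr_mono {q : (∀ i, 𝔛 i) → ℝ} (hq : ∀ v, 0 ≤ q v) {E F : (∀ i, 𝔛 i) → Prop}
    (h : ∀ v, E v → F v) : pr q E ≤ pr q F :=
  Finset.sum_le_sum fun v _ => Set.indicator_le_indicator_of_subset (fun v hv => h v hv) hq v

open scoped Classical in
theorem pr_eq_sum_ite (q : (∀ i, 𝔛 i) → ℝ) (E : (∀ i, 𝔛 i) → Prop) :
    pr q E = ∑ v, if E v then q v else 0 :=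
  Finset.sum_congr rfl fun v _ => Set.indicator_apply (Set.ofPred E) q v

theorem pr_agree_empty {q : (∀ i, 𝔛 i) → ℝ} (hq : IsProb q) (w : ∀ i, 𝔛 i) :
    pr q (agree ∅ w) = 1 := by
  simp [pr_eq_sum_ite, agree, hq.2]

/-- Marginalisation of one coordinate. -/
theorem pr_agree_eq_sum (q : (∀ i, 𝔛 i) → ℝ) {S : Finset V} {k : V} (hk : k ∉ S)
    (w : ∀ i, 𝔛 i) :
    pr q (agree S w) = ∑ x, pr q (agree (insert k S) (Function.update w k x)) := by
  classical
  have key : ∀ (v : ∀ i, 𝔛 i) (x : 𝔛 k),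
      agree (insert k S) (Function.update w k x) v ↔ v k = x ∧ agree S w v := by
    intro v x
    have : ∀ j ∈ S, Function.update w k x j = w j := fun j hj =>
      Function.update_of_ne (ne_of_mem_of_not_mem hj hk) _ _
    simp +contextual [agree, this]
  simp only [pr_eq_sum_ite, key]
  rw [Finset.sum_comm]
  refine Finset.sum_congr rfl fun v _ => ?_
  rw [Finset.sum_eq_single (v k)]
  · simp
  · intro x _ hx
    simp [hx.symm]
  · simp

theorem eq_pre_of_isLowerSet_insert {S : Finset V} {k : V} (hlt : ∀ x ∈ S, x < k)
    (hS : IsLowerSet ((insert k S : Finset V) : Set V)) : S = pre k := by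
  ext j
  simp only [pre, mem_filter, mem_univ, true_and]
  refine ⟨hlt j, fun hj => ?_⟩
  have : j ∈ insert k S := hS hj.le (mem_insert_self k S)
  exact (mem_insert.mp this).resolve_left hj.ne

theorem isLowerSet_pre (k : V) : IsLowerSet (pre k : Set V) := by
  intro a b hba ha
  simp only [pre, coe_filter, mem_univ, true_and, Set.mem_ofPred_eq] at ha ⊢
  exact hba.trans_lt ha

theorem isLowerSet_insert_pre (k : V) :
    IsLowerSet ((insert k (pre k) : Finset V) : Set V) := by
  intro a b hba ha
  simp only [pre, coe_insert, coe_filter, mem_univ, true_and, Set.mem_insert_iff,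
    Set.mem_ofPred_eq] at ha ⊢
  exact (le_iff_eq_or_lt.mp (hba.trans (le_iff_eq_or_lt.mpr ha)))

theorem notMem_pre (k : V) : k ∉ pre k := by simp [pre]

omit [∀ i, Fintype (𝔛 i)] in
theorem agree_insert_pre_iff (i : V) (w v : ∀ j, 𝔛 j) (x : 𝔛 i) :
    (v i = x ∧ agree (pre i) w v) ↔ agree (insert i (pre i)) (Function.update w i x) v := by
  have : ∀ j ∈ pre i, Function.update w i x j = w j := fun j hj =>
    Function.update_of_ne (ne_of_mem_of_not_mem hj (notMem_pre i)) _ _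
  simp +contextual [agree, this]

omit [Fintype V] [∀ i, Fintype (𝔛 i)] in
theorem suppIn_setOn (A : Finset V) (a : ∀ i, 𝔛 i) : suppIn (setOn A a) A := by
  intro i hi
  by_contra h
  exact hi (if_neg h)

/-- Under the SWIG local Markov property, the law of an initial segment of the variables does not
depend on interventions on variables that precede none of its members. -/
theorem SWIGLocalMarkov.pr_agree_congr {A : Finset V} {pa : V → Finset V}
    {P : (∀ i, Option (𝔛 i)) → (∀ i, 𝔛 i) → ℝ} (hM : SWIGLocalMarkov A pa P)
    (hpa : ∀ i, pa i ⊆ pre i) (hP : ∀ f, suppIn f A → IsProb (P f))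
    {a a' : ∀ i, 𝔛 i} (w : ∀ i, 𝔛 i) (S : Finset V) (hS : IsLowerSet (S : Set V))
    (haa' : ∀ k ∈ S, ∀ j < k, a j = a' j) :
    pr (P (setOn A a)) (agree S w) = pr (P (setOn A a')) (agree S w) := by
  have hprob := fun b => hP _ (suppIn_setOn A b)
  induction S using Finset.induction_on_max with
  | empty => rw [pr_agree_empty (hprob a), pr_agree_empty (hprob a')]
  | insert k S hlt ih =>
    obtain rfl := eq_pre_of_isLowerSet_insert hlt hS
    have ih := ih (isLowerSet_pre k) fun m hm => haa' m (mem_insert_of_mem hm)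
    have hle : ∀ b, pr (P (setOn A b)) (agree (insert k (pre k)) w)
        ≤ pr (P (setOn A b)) (agree (pre k) w) := fun b =>
      pr_mono (hprob b).1 fun v hv j hj => hv j (mem_insert_of_mem hj)
    have hnn : ∀ b E, 0 ≤ pr (P (setOn A b)) E := fun b => pr_nonneg (hprob b).1
    rcases (hnn a (agree (pre k) w)).eq_or_lt with h0 | hpos
    · exact (le_antisymm ((hle a).trans h0.ge) (hnn _ _)).trans
        (le_antisymm ((hle a').trans (h0.trans ih).ge) (hnn _ _)).symm
    · have h := hM k a a' w w (w k) hpos (ih ▸ hpos)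
        (fun j hj => haa' k (mem_insert_self _ _) j
          (mem_filter.mp (hpa k (mem_inter.mp hj).1)).2) (fun _ _ => rfl)
      have hE : (fun v : ∀ j, 𝔛 j => v k = w k ∧ agree (pre k) w v)
          = agree (insert k (pre k)) w := by
        ext v
        simp [agree]
      unfold cpr at h
      rw [hE, ih] at h
      exact (div_left_inj' (ih ▸ hpos).ne').mp h

/-- Iterated distributional consistency. -/
theorem DistConsistent.pr_agree_univ {A : Finset V}
    {P : (∀ i, Option (𝔛 i)) → (∀ i, 𝔛 i) → ℝ} (hDC : DistConsistent A P) (w : ∀ i, 𝔛 i)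
    {C : Finset V} (hC : C ⊆ A) :
    pr (P (setOn C w)) (agree univ w) = pr (P (fun _ => none)) (agree univ w) := by
  induction C using Finset.induction_on with
  | empty =>
    congr 2
  | insert i C hi ih =>
    rw [← ih ((subset_insert i C).trans hC)]
    have h := hDC i (hC (mem_insert_self i C)) C (fun j hj => by
      simp only [mem_sdiff, mem_singleton]
      exact ⟨hC (mem_insert_of_mem hj), ne_of_mem_of_not_mem hj hi⟩) w (w i) w
    have hE : (fun v : ∀ j, 𝔛 j => agree (univ \ {i}) w v ∧ v i = w i) = agree univ w := by
      ext v
      refine ⟨fun h j _ => ?_, fun h => ⟨fun j _ => h j (mem_univ j), h i (mem_univ i)⟩⟩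
      rcases eq_or_ne j i with rfl | hj
      · exact h.2
      · exact h.1 j (by simpa using hj)
    have hU : Function.update (setOn C w) i (some (w i)) = setOn (insert i C) w := by
      ext1 j
      rcases eq_or_ne j i with rfl | hj
      · simp [setOn]
      · simp [setOn, hj]
    rwa [hE, hU] at h

/-- The observed law of an initial segment coincides with its law under the intervention
that sets the targets to the values in question. -/
theorem pr_agree_observed_eq {A : Finset V} {pa : V → Finset V}
    {P : (∀ i, Option (𝔛 i)) → (∀ i, 𝔛 i) → ℝ} (hpa : ∀ i, pa i ⊆ pre i)
    (hP : ∀ f, suppIn f A → IsProb (P f)) (hDC : DistConsistent A P)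
    (hM : SWIGLocalMarkov A pa P) (T : Finset V) (hT : IsLowerSet ((Tᶜ : Finset V) : Set V))
    (w : ∀ i, 𝔛 i) :
    pr (P (fun _ => none)) (agree Tᶜ w) = pr (P (setOn A w)) (agree Tᶜ w) := by
  induction T using Finset.induction_on_min generalizing w with
  | empty => rw [compl_empty, hDC.pr_agree_univ w Subset.rfl]
  | insert k T hlt ih =>
    have hkT : k ∉ T := fun h => (hlt k h).false
    have hins : insert k (insert k T)ᶜ = Tᶜ := by
      ext j
      by_cases hj : j = k <;> simp [hj, hkT]
    have hpre : (insert k T)ᶜ = pre k := by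
      ext j
      simp only [mem_compl, mem_insert, pre, mem_filter, mem_univ, true_and]
      refine ⟨fun hj => ?_, fun hj => ?_⟩
      · by_contra hn
        have hkj : k ≤ j := not_lt.mp hn
        have : k ∈ ((insert k T)ᶜ : Finset V) := hT hkj (by simpa [and_comm] using hj)
        simp at this
      · rintro (h | h)
        · exact hj.ne h
        · exact (hlt j h).not_gt hj
    rw [hpre] at hins ⊢
    rw [← hins] at ih
    rw [pr_agree_eq_sum _ (notMem_pre k), pr_agree_eq_sum _ (notMem_pre k)]
    refine Finset.sum_congr rfl fun x _ => ?_
    rw [ih (isLowerSet_insert_pre k)]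
    refine hM.pr_agree_congr hpa hP _ _ (isLowerSet_insert_pre k) fun m hm j hj => ?_
    refine Function.update_of_ne (ne_of_lt (hj.trans_le ?_)) _ _
    rcases mem_insert.mp hm with rfl | hm
    · exact le_rfl
    · exact (mem_filter.mp hm).2.le

/-- Theorem 1: distributional consistency plus the SWIG ordered local Markov
property imply the ordinary ordered local Markov property for the observed
distribution `p(V) = P (fun _ => none)`. -/
theorem stmt6_observed_markov
    (A : Finset V) (hA : A ⊆ univ)
    (pa : V → Finset V) (hpa : ∀ i, pa i ⊆ pre i)
    (P : (∀ i, Option (𝔛 i)) → (∀ i, 𝔛 i) → ℝ)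
    (hP : ∀ f, suppIn f A → IsProb (P f))
    (hDC : DistConsistent A P)
    (hM : SWIGLocalMarkov A pa P) :
    OrderedLocalMarkov pa (P (fun _ => none)) := by
  have hobs : ∀ (S : Finset V) (_ : IsLowerSet (S : Set V)) (w : ∀ i, 𝔛 i),
      pr (P (fun _ => none)) (agree S w) = pr (P (setOn A w)) (agree S w) := fun S hS w => by
    simpa only [compl_compl] using
      pr_agree_observed_eq hpa hP hDC hM Sᶜ (by rwa [compl_compl]) w
  have hcpr : ∀ (i : V) (w : ∀ j, 𝔛 j) (x : 𝔛 i),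
      cpr (P (fun _ => none)) (fun v => v i = x) (agree (pre i) w)
        = cpr (P (setOn A w)) (fun v => v i = x) (agree (pre i) w) := by
    intro i w x
    unfold cpr
    simp only [agree_insert_pre_iff]
    change pr _ (agree _ _) / _ = pr _ (agree _ _) / _
    rw [hobs _ (isLowerSet_pre i), hobs _ (isLowerSet_insert_pre i)]
    congr 1
    refine hM.pr_agree_congr hpa hP _ _ (isLowerSet_insert_pre i) fun m hm j hj => ?_
    refine Function.update_of_ne (ne_of_lt (hj.trans_le ?_)) _ _
    rcases mem_insert.mp hm with rfl | hm
    · exact le_rfl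
    · exact (mem_filter.mp hm).2.le
  intro i w w' x hw hw' hww'
  rw [hcpr, hcpr]
  rw [hobs _ (isLowerSet_pre i)] at hw hw'
  exact hM i w w' w w' x hw hw' (fun j hj => hww' j (mem_inter.mp hj).1)
    (fun j hj => hww' j (mem_sdiff.mp hj).1)

end CausalPaper
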